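/- Lemma B.12 (stability of the OMD step): If the initial learning rate satisfies η ≤ 1/(80d), then Algorithm 2 guarantees ‖w⁺_t − w⁺_{t+1}‖_{H_t} ≤ 40η·‖ℓ̂⁺_t‖_{H_t^{−1}} for all t ∈ [T], where H_t = ∇²Ψ(w⁺_t). -/

import Mathlib

open MeasureTheory Real Finset Matrix

/-! Common notions for the linear-bandit setting (self-concordant barriers,
the lifted normal barrier, quadratic norms, Bregman divergences, Minkowsky functions). -/

/-- Euclidean dot product on `ℝ^n`. -/
noncomputable def dotp {n : ℕ} (x y : Fin n → ℝ) : ℝ := ∑ i, x i * y i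

/-- Quadratic norm `‖h‖_M = √(hᵀ M h)`. -/
noncomputable def qnorm {n : ℕ} (M : Matrix (Fin n) (Fin n) ℝ) (h : Fin n → ℝ) : ℝ :=
  Real.sqrt (dotp h (M.mulVec h))

/-- First directional derivative `Df(x)[h]`. -/
noncomputable def der1 {n : ℕ} (f : (Fin n → ℝ) → ℝ) (x h : Fin n → ℝ) : ℝ :=
  fderiv ℝ f x h

/-- Second directional derivative `D²f(x)[h₁,h₂]`. -/
noncomputable def der2 {n : ℕ} (f : (Fin n → ℝ) → ℝ) (x h₁ h₂ : Fin n → ℝ) : ℝ :=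
  iteratedFDeriv ℝ 2 f x ![h₁, h₂]

/-- Third directional derivative `D³f(x)[h,h,h]`. -/
noncomputable def der3 {n : ℕ} (f : (Fin n → ℝ) → ℝ) (x h : Fin n → ℝ) : ℝ :=
  iteratedFDeriv ℝ 3 f x ![h, h, h]

/-- Hessian matrix `∇²f(x)`. -/
noncomputable def hess {n : ℕ} (f : (Fin n → ℝ) → ℝ) (x : Fin n → ℝ) :
    Matrix (Fin n) (Fin n) ℝ :=
  Matrix.of fun i j => der2 f x (Pi.single i 1) (Pi.single j 1)

/-- Gradient vector `∇f(x)`. -/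
noncomputable def gradv {n : ℕ} (f : (Fin n → ℝ) → ℝ) (x : Fin n → ℝ) : Fin n → ℝ :=
  fun i => fderiv ℝ f x (Pi.single i 1)

/-- Bregman divergence `D_f(u,w) = f(u) − f(w) − ⟨∇f(w), u − w⟩`. -/
noncomputable def breg {n : ℕ} (f : (Fin n → ℝ) → ℝ) (u w : Fin n → ℝ) : ℝ :=
  f u - f w - dotp (gradv f w) (u - w)

/-- `ψ` is a `ν`-self-concordant barrier for `K`. -/
structure IsSCB {n : ℕ} (K : Set (Fin n → ℝ)) (ψ : (Fin n → ℝ) → ℝ) (ν : ℝ) : Prop where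
  smooth : ContDiffOn ℝ 3 ψ (interior K)
  convexOn : ConvexOn ℝ (interior K) ψ
  blowup : ∀ x ∈ frontier K, Filter.Tendsto ψ (nhdsWithin x (interior K)) Filter.atTop
  selfConc : ∀ w ∈ interior K, ∀ h, |der3 ψ w h| ≤ 2 * Real.sqrt (der2 ψ w h h) ^ 3
  gradBound : ∀ w ∈ interior K, ∀ h,
    |der1 ψ w h| ≤ Real.sqrt ν * Real.sqrt (der2 ψ w h h)

/-- Lift `w ∈ ℝ^d` to `(w,1) ∈ ℝ^{d+1}`. -/
noncomputable def liftv {d : ℕ} (w : Fin d → ℝ) : Fin (d + 1) → ℝ := Fin.snoc w 1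

/-- The lifted barrier `Ψ(w,b) = 400 (ψ(w/b) − 2ν ln b)`, an `800ν`-normal barrier on
the conic hull of `Ω⁺`. -/
noncomputable def liftedBarrier {d : ℕ} (ψ : (Fin d → ℝ) → ℝ) (ν : ℝ) :
    (Fin (d + 1) → ℝ) → ℝ :=
  fun x => 400 * (ψ (fun i => x i.castSucc / x (Fin.last d)) -
    2 * ν * Real.log (x (Fin.last d)))

/-- Minkowsky function `π_w(u) = inf {s > 0 : w + (u − w)/s ∈ K}`. -/
noncomputable def mink {n : ℕ} (K : Set (Fin n → ℝ)) (w u : Fin n → ℝ) : ℝ :=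
  sInf {s : ℝ | 0 < s ∧ w + s⁻¹ • (u - w) ∈ K}

lemma line_deriv {n : ℕ} {f : (Fin n → ℝ) → ℝ} {x h : Fin n → ℝ} {τ : ℝ} (m : ℕ)
    (hf : ContDiffAt ℝ (m + 1 : ℕ) f (x + τ • h)) :
    HasDerivAt (fun τ : ℝ => iteratedFDeriv ℝ m f (x + τ • h) (fun _ => h))
      (iteratedFDeriv ℝ (m + 1) f (x + τ • h) (fun _ => h)) τ := by
  have h1 : DifferentiableAt ℝ (iteratedFDeriv ℝ m f) (x + τ • h) := by
    apply hf.differentiableAt_iteratedFDeriv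
    exact_mod_cast Nat.lt_succ_self m
  have h2 : HasDerivAt (fun τ : ℝ => x + τ • h) h τ := by
    simpa using ((hasDerivAt_id τ).smul_const h).const_add x
  have h3 := h1.hasFDerivAt.comp_hasDerivAt τ h2
  have h4 := ((ContinuousMultilinearMap.apply ℝ (fun _ : Fin m => Fin n → ℝ) ℝ
    (fun _ => h)).hasFDerivAt).comp_hasDerivAt τ h3
  exact h4

lemma it2 {n : ℕ} (f : (Fin n → ℝ) → ℝ) (x h : Fin n → ℝ) :
    iteratedFDeriv ℝ 2 f x (fun _ => h) = der2 f x h h := by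
  unfold der2; congr 1; ext i; fin_cases i <;> rfl

lemma it3 {n : ℕ} (f : (Fin n → ℝ) → ℝ) (x h : Fin n → ℝ) :
    iteratedFDeriv ℝ 3 f x (fun _ => h) = der3 f x h := by
  unfold der3; congr 1; ext i; fin_cases i <;> rfl

lemma it1 {n : ℕ} (f : (Fin n → ℝ) → ℝ) (x h : Fin n → ℝ) :
    iteratedFDeriv ℝ 1 f x (fun _ => h) = der1 f x h := by
  simp [der1]

lemma hd0 {n : ℕ} {f : (Fin n → ℝ) → ℝ} {x h : Fin n → ℝ} {τ : ℝ}
    (hf : ContDiffAt ℝ 3 f (x + τ • h)) :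
    HasDerivAt (fun τ : ℝ => f (x + τ • h)) (der1 f (x + τ • h) h) τ := by
  have := line_deriv (h := h) 0 (hf.of_le (by norm_num))
  rw [it1] at this
  simpa using this

lemma hd1 {n : ℕ} {f : (Fin n → ℝ) → ℝ} {x h : Fin n → ℝ} {τ : ℝ}
    (hf : ContDiffAt ℝ 3 f (x + τ • h)) :
    HasDerivAt (fun τ : ℝ => der1 f (x + τ • h) h) (der2 f (x + τ • h) h h) τ := by
  have := line_deriv (h := h) 1 (hf.of_le (by norm_num))
  simp only [it1] at this
  rw [it2] at this
  exact this

lemma hd2 {n : ℕ} {f : (Fin n → ℝ) → ℝ} {x h : Fin n → ℝ} {τ : ℝ}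
    (hf : ContDiffAt ℝ 3 f (x + τ • h)) :
    HasDerivAt (fun τ : ℝ => der2 f (x + τ • h) h h) (der3 f (x + τ • h) h) τ := by
  have := line_deriv (h := h) 2 (hf.of_le (by norm_num))
  simp only [it2] at this
  rw [it3] at this
  exact this

lemma sc1d {s : Set ℝ} (hs : Convex ℝ s) {y y' : ℝ → ℝ}
    (hy : ∀ τ ∈ s, HasDerivAt y (y' τ) τ) (h0 : ∀ τ ∈ s, 0 ≤ y τ)
    (hc : ∀ τ ∈ s, |y' τ| ≤ 2 * √(y τ) ^ 3) {a b : ℝ} (ha : a ∈ s) (hb : b ∈ s) :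
    √(y a) ≤ √(y b) * (1 + |b - a| * √(y a)) := by
  have key : ∀ ε > 0, √(y a + ε) ≤ √(y b + ε) * (1 + |b - a| * √(y a + ε)) := by
    intro ε hε
    have hder : ∀ τ ∈ s, HasDerivWithinAt (fun τ => (√(y τ + ε))⁻¹)
        (-(y' τ / (2 * √(y τ + ε))) / √(y τ + ε) ^ 2) s τ := by
      intro τ hτ
      have hp : 0 < y τ + ε := by linarith [h0 τ hτ]
      exact ((((hy τ hτ).add_const ε).sqrt hp.ne').inv (Real.sqrt_pos.2 hp).ne').hasDerivWithinAt
    have hb1 : ∀ τ ∈ s, ‖-(y' τ / (2 * √(y τ + ε))) / √(y τ + ε) ^ 2‖ ≤ 1 := by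
      intro τ hτ
      have hp : 0 < y τ + ε := by linarith [h0 τ hτ]
      have hq := Real.sqrt_pos.2 hp
      have hle : √(y τ) ≤ √(y τ + ε) := Real.sqrt_le_sqrt (by linarith)
      have h3 : √(y τ) ^ 3 ≤ √(y τ + ε) ^ 3 := by gcongr
      rw [Real.norm_eq_abs, abs_div, abs_neg, abs_div, abs_of_pos (by positivity : 0 < 2 * √(y τ + ε)),
        abs_of_pos (by positivity : 0 < √(y τ + ε) ^ 2), div_div, div_le_one (by positivity)]
      nlinarith [hc τ hτ]
    have := hs.norm_image_sub_le_of_norm_hasDerivWithin_le hder hb1 ha hb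
    rw [Real.norm_eq_abs, Real.norm_eq_abs, one_mul] at this
    have h5 := (abs_le.1 this).2
    have hpa : 0 < √(y a + ε) := Real.sqrt_pos.2 (by linarith [h0 a ha])
    have hpb : 0 < √(y b + ε) := Real.sqrt_pos.2 (by linarith [h0 b hb])
    have h6 : (√(y b + ε))⁻¹ ≤ (√(y a + ε))⁻¹ + |b - a| := by linarith
    have h7 := mul_le_mul_of_nonneg_left h6 (mul_pos hpa hpb).le
    calc √(y a + ε) = √(y a + ε) * √(y b + ε) * (√(y b + ε))⁻¹ := by field_simp
      _ ≤ _ := h7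
      _ = _ := by field_simp
  have hl : Filter.Tendsto (fun ε => √(y a + ε)) (nhdsWithin 0 (Set.Ioi 0)) (nhds (√(y a))) := by
    have : Continuous (fun ε => √(y a + ε)) := by fun_prop
    simpa using (this.tendsto 0).mono_left nhdsWithin_le_nhds
  have hr : Filter.Tendsto (fun ε => √(y b + ε) * (1 + |b - a| * √(y a + ε)))
      (nhdsWithin 0 (Set.Ioi 0)) (nhds (√(y b) * (1 + |b - a| * √(y a)))) := by
    have : Continuous (fun ε => √(y b + ε) * (1 + |b - a| * √(y a + ε))) := by fun_prop
    simpa using (this.tendsto 0).mono_left nhdsWithin_le_nhds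
  refine le_of_tendsto_of_tendsto hl hr ?_
  filter_upwards [self_mem_nhdsWithin] with ε hε using key ε hε

/-- Bregman lower bound along a line. -/
lemma gap1d {g g1 g2 : ℝ → ℝ} 
    (h0 : ∀ τ ∈ Set.Icc (0:ℝ) 1, HasDerivAt g (g1 τ) τ)
    (h1 : ∀ τ ∈ Set.Icc (0:ℝ) 1, HasDerivAt g1 (g2 τ) τ) 
    (hn : ∀ τ ∈ Set.Icc (0:ℝ) 1, 0 ≤ g2 τ)
    (hc : ∀ τ ∈ Set.Icc (0:ℝ) 1, √(g2 0) ≤ √(g2 τ) * (1 + τ * √(g2 0))) :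
    √(g2 0) ^ 2 / (2 * (1 + √(g2 0))) ≤ g 1 - g 0 - g1 0 := by
  set ρ := √(g2 0) with hρ
  have hρ0 : 0 ≤ ρ := Real.sqrt_nonneg _
  have hlow : ∀ τ ∈ Set.Icc (0:ℝ) 1, ρ ^ 2 / (1 + τ * ρ) ^ 2 ≤ g2 τ := by
    intro τ hτ
    have hp : 0 < 1 + τ * ρ := by have := mul_nonneg hτ.1 hρ0; linarith
    rw [div_le_iff₀ (by positivity)]
    calc ρ ^ 2 ≤ (√(g2 τ) * (1 + τ * ρ)) ^ 2 := by gcongr; exact hc τ hτ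
      _ = _ := by rw [mul_pow, Real.sq_sqrt (hn τ hτ)]
  have m1 : MonotoneOn (fun τ => g1 τ - ρ ^ 2 * τ / (1 + τ * ρ)) (Set.Icc 0 1) := by
    have hd : ∀ τ ∈ Set.Icc (0:ℝ) 1, HasDerivAt (fun τ => g1 τ - ρ ^ 2 * τ / (1 + τ * ρ))
        (g2 τ - ρ ^ 2 / (1 + τ * ρ) ^ 2) τ := by
      intro τ hτ
      have hp : 0 < 1 + τ * ρ := by have := mul_nonneg hτ.1 hρ0; linarith
      have e := ((hasDerivAt_id τ).const_mul (ρ ^ 2)).div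
        (((hasDerivAt_id τ).mul_const ρ).const_add 1) hp.ne'
      have e2 := (h1 τ hτ).sub e
      refine e2.congr_deriv ?_
      simp only [id]
      congr 2
      ring
    refine monotoneOn_of_hasDerivWithinAt_nonneg (convex_Icc 0 1)
      (fun τ hτ => (hd τ hτ).continuousAt.continuousWithinAt)
      (fun τ hτ => (hd τ (interior_subset hτ)).hasDerivWithinAt) ?_
    intro τ hτ
    linarith [hlow τ (interior_subset hτ)]
  have b1 : ∀ τ ∈ Set.Icc (0:ℝ) 1, g1 0 + ρ ^ 2 * τ / (1 + ρ) ≤ g1 τ := by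
    intro τ hτ
    have e := m1 (Set.left_mem_Icc.2 zero_le_one) hτ hτ.1
    simp only [mul_zero, zero_div, sub_zero] at e
    have hp : 0 < 1 + τ * ρ := by have := mul_nonneg hτ.1 hρ0; linarith
    have : ρ ^ 2 * τ / (1 + ρ) ≤ ρ ^ 2 * τ / (1 + τ * ρ) := by
      have := hτ.1
      gcongr
      nlinarith [hτ.2]
    linarith
  have m2 : MonotoneOn (fun τ => g τ - g1 0 * τ - ρ ^ 2 / (1 + ρ) * (τ ^ 2 / 2)) (Set.Icc 0 1) := by
    have hd : ∀ τ ∈ Set.Icc (0:ℝ) 1,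
        HasDerivAt (fun τ => g τ - g1 0 * τ - ρ ^ 2 / (1 + ρ) * (τ ^ 2 / 2))
        (g1 τ - g1 0 - ρ ^ 2 / (1 + ρ) * τ) τ := by
      intro τ hτ
      have e := ((h0 τ hτ).sub ((hasDerivAt_id τ).const_mul (g1 0))).sub
        (((hasDerivAt_pow 2 τ).div_const 2).const_mul (ρ ^ 2 / (1 + ρ)))
      refine e.congr_deriv ?_
      simp
    refine monotoneOn_of_hasDerivWithinAt_nonneg (convex_Icc 0 1)
      (fun τ hτ => (hd τ hτ).continuousAt.continuousWithinAt)
      (fun τ hτ => (hd τ (interior_subset hτ)).hasDerivWithinAt) ?_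
    intro τ hτ
    have := b1 τ (interior_subset hτ)
    rw [mul_div_right_comm] at this
    linarith
  have e := m2 (Set.left_mem_Icc.2 zero_le_one) (Set.right_mem_Icc.2 zero_le_one) zero_le_one
  simp only [mul_zero, mul_one] at e
  have : ρ ^ 2 / (2 * (1 + ρ)) = ρ ^ 2 / (1 + ρ) * (1 ^ 2 / 2) := by field_simp
  rw [this]
  linarith

lemma scb_cd {n : ℕ} {K : Set (Fin n → ℝ)} {ψ : (Fin n → ℝ) → ℝ} {ν : ℝ} (hψ : IsSCB K ψ ν)
    {w : Fin n → ℝ} (hw : w ∈ interior K) : ContDiffAt ℝ 3 ψ w :=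
  hψ.smooth.contDiffAt (isOpen_interior.mem_nhds hw)

lemma scb_nonneg {n : ℕ} {K : Set (Fin n → ℝ)} {ψ : (Fin n → ℝ) → ℝ} {ν : ℝ} (hψ : IsSCB K ψ ν)
    {w : Fin n → ℝ} (hw : w ∈ interior K) (h : Fin n → ℝ) : 0 ≤ der2 ψ w h h := by
  by_contra hneg
  push Not at hneg
  have hw0 : w + (0:ℝ) • h ∈ interior K := by simpa using hw
  have c2 := (hd2 (h := h) (scb_cd hψ hw0)).continuousAt
  have e1 : ∀ᶠ τ in nhds (0:ℝ), der2 ψ (w + τ • h) h h < 0 :=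
    c2.eventually_lt continuousAt_const (by simpa using hneg)
  have cl : ContinuousAt (fun τ : ℝ => w + τ • h) 0 := by fun_prop
  have e2 : ∀ᶠ τ in nhds (0:ℝ), w + τ • h ∈ interior K :=
    cl.eventually_mem (isOpen_interior.mem_nhds hw0)
  have e3 : (fun τ : ℝ => der1 ψ (w + τ • h) h) =ᶠ[nhds 0] fun _ => (0:ℝ) := by
    filter_upwards [e1, e2] with τ h1 h2
    have := hψ.gradBound _ h2 h
    rw [Real.sqrt_eq_zero_of_nonpos h1.le, mul_zero] at this
    exact abs_nonpos_iff.1 this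
  have d1 := (hd1 (h := h) (scb_cd hψ hw0))
  have d2 := (hasDerivAt_const (0:ℝ) (0:ℝ)).congr_of_eventuallyEq e3
  have := d1.unique d2
  rw [zero_smul, add_zero] at this
  linarith

/-- crude Dikin ellipsoid inclusion -/
lemma dikin {n : ℕ} {K : Set (Fin n → ℝ)} {ψ : (Fin n → ℝ) → ℝ} {ν : ℝ} (hψ : IsSCB K ψ ν)
    {w : Fin n → ℝ} (hw : w ∈ interior K) (h : Fin n → ℝ) (hh : √(der2 ψ w h h) ≤ 1 / 2) :
    w + h ∈ interior K := by
  by_contra hnot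
  have cl : Continuous (fun τ : ℝ => w + τ • h) := by fun_prop
  set A : Set ℝ := Set.Icc 0 1 ∩ {τ | w + τ • h ∉ interior K} with hA
  have hAc : IsCompact A := isCompact_Icc.inter_right
    ((isOpen_interior.preimage cl).isClosed_compl)
  have hAn : A.Nonempty := ⟨1, by simp, by simpa using hnot⟩
  obtain ⟨τs, hτs, hmin⟩ := hAc.exists_isLeast hAn
  have hpos : 0 < τs := by
    rcases hτs.1.1.eq_or_lt with h0 | h0
    · exact absurd (by simpa [← h0] using hw) hτs.2
    · exact h0
  have hin : ∀ τ ∈ Set.Ico 0 τs, w + τ • h ∈ interior K := by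
    intro τ hτ
    by_contra hc
    have := hmin (show τ ∈ A from ⟨⟨hτ.1, hτ.2.le.trans hτs.1.2⟩, hc⟩)
    linarith [hτ.2]
  have hS := @sc1d _ (convex_Ico 0 τs) (fun τ => der2 ψ (w + τ • h) h h) _
    (fun τ hτ => hd2 (scb_cd hψ (hin τ hτ))) (fun τ hτ => scb_nonneg hψ (hin τ hτ) h)
    (fun τ hτ => hψ.selfConc _ (hin τ hτ) h)
  have h1 : ∀ τ ∈ Set.Ico 0 τs, √(der2 ψ (w + τ • h) h h) ≤ 1 := by
    intro τ hτ
    have := @hS τ 0 hτ ⟨le_rfl, hpos⟩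
    simp only [zero_smul, add_zero, zero_sub, abs_neg, abs_of_nonneg hτ.1] at this
    have hτ1 : τ ≤ 1 := hτ.2.le.trans hτs.1.2
    have hz := Real.sqrt_nonneg (der2 ψ (w + τ • h) h h)
    have hz' := Real.sqrt_nonneg (der2 ψ w h h)
    nlinarith [mul_nonneg hz (sub_nonneg.2 hτ1), mul_nonneg (mul_nonneg hz hτ.1) (sub_nonneg.2 hh)]
  have h2 : ∀ τ ∈ Set.Ico 0 τs, ψ (w + τ • h) ≤ ψ w + √ν := by
    intro τ hτ
    have := (convex_Ico 0 τs).norm_image_sub_le_of_norm_hasDerivWithin_le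
      (f := fun τ : ℝ => ψ (w + τ • h)) (C := √ν)
      (fun x hx => (hd0 (scb_cd hψ (hin x hx))).hasDerivWithinAt)
      (fun x hx => (hψ.gradBound _ (hin x hx) h).trans
        (mul_le_of_le_one_right (Real.sqrt_nonneg _) (h1 x hx))) (x := 0) (y := τ) ⟨le_rfl, hpos⟩ hτ
    rw [Real.norm_eq_abs, Real.norm_eq_abs, sub_zero, abs_of_nonneg hτ.1] at this
    have h3 := (abs_le.1 this).2
    simp only [zero_smul, add_zero] at h3
    have hτ1 : τ ≤ 1 := hτ.2.le.trans hτs.1.2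
    nlinarith [Real.sqrt_nonneg ν]
  have ht : Filter.Tendsto (fun τ : ℝ => w + τ • h) (nhdsWithin τs (Set.Iio τs))
      (nhdsWithin (w + τs • h) (interior K)) := by
    refine tendsto_nhdsWithin_iff.2 ⟨(cl.tendsto τs).mono_left nhdsWithin_le_nhds, ?_⟩
    filter_upwards [Ico_mem_nhdsLT hpos] with τ hτ using hin τ hτ
  have hfr : w + τs • h ∈ frontier K := by
    refine ⟨closure_mono interior_subset ?_, hτs.2⟩
    exact mem_closure_of_tendsto (ht.mono_right nhdsWithin_le_nhds)
      (by filter_upwards [Ico_mem_nhdsLT hpos] with τ hτ using hin τ hτ)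
  have hb := (hψ.blowup _ hfr).comp ht
  have hb2 := hb.eventually_gt_atTop (ψ w + √ν)
  obtain ⟨τ, h3, h4⟩ := (hb2.and (Ico_mem_nhdsLT hpos)).exists
  exact absurd h3 (not_lt.2 (h2 τ h4))

lemma clm_sum {n : ℕ} {M : Type*} [NormedAddCommGroup M] [NormedSpace ℝ M]
    (L : (Fin n → ℝ) →L[ℝ] M) (h : Fin n → ℝ) : L h = ∑ i, h i • L (Pi.single i 1) := by
  have h1 : h = ∑ i, h i • (Pi.single i (1:ℝ) : Fin n → ℝ) := by
    ext j
    simp [Finset.sum_apply, Pi.single_apply]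
  conv_lhs => rw [h1]
  simp

lemma hess_quad {n : ℕ} (f : (Fin n → ℝ) → ℝ) (x h : Fin n → ℝ) :
    dotp h ((hess f x).mulVec h) = der2 f x h h := by
  have e : ∀ a b, der2 f x a b = fderiv ℝ (fderiv ℝ f) x a b := by
    intro a b; simp [der2, iteratedFDeriv_two_apply]
  simp only [dotp, Matrix.mulVec, dotProduct, hess, Matrix.of_apply, e]
  rw [clm_sum (fderiv ℝ (fderiv ℝ f) x) h, ContinuousLinearMap.sum_apply]
  refine Finset.sum_congr rfl fun i _ => ?_
  rw [ContinuousLinearMap.smul_apply, smul_eq_mul, clm_sum _ h]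
  congr 1
  exact Finset.sum_congr rfl fun j _ => by rw [smul_eq_mul, mul_comm]

lemma grad_dot {n : ℕ} (f : (Fin n → ℝ) → ℝ) (x h : Fin n → ℝ) :
    dotp (gradv f x) h = der1 f x h := by
  simp only [dotp, gradv, der1]
  rw [clm_sum _ h]
  exact Finset.sum_congr rfl fun j _ => by rw [smul_eq_mul, mul_comm]

/-- lift of a direction -/
noncomputable def lift0 {d : ℕ} (h : Fin d → ℝ) : Fin (d + 1) → ℝ := Fin.snoc h 0

lemma lift_add {d : ℕ} (w h : Fin d → ℝ) : liftv w + lift0 h = liftv (w + h) := by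
  ext i
  refine Fin.lastCases ?_ (fun j => ?_) i <;> simp [liftv, lift0]

lemma lift_line {d : ℕ} (w h : Fin d → ℝ) (τ : ℝ) :
    liftv w + τ • lift0 h = liftv (w + τ • h) := by
  ext i
  refine Fin.lastCases ?_ (fun j => ?_) i <;> simp [liftv, lift0]

lemma lift_sub {d : ℕ} (w h : Fin d → ℝ) : liftv w - liftv h = lift0 (w - h) := by
  ext i
  refine Fin.lastCases ?_ (fun j => ?_) i <;> simp [liftv, lift0]

lemma lb_lift {d : ℕ} (ψ : (Fin d → ℝ) → ℝ) (ν : ℝ) (w : Fin d → ℝ) :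
    liftedBarrier ψ ν (liftv w) = 400 * ψ w := by
  simp [liftedBarrier, liftv]

lemma lb_cd {d : ℕ} {ψ : (Fin d → ℝ) → ℝ} (ν : ℝ) {w : Fin d → ℝ} (h : ContDiffAt ℝ 3 ψ w) :
    ContDiffAt ℝ 3 (liftedBarrier ψ ν) (liftv w) := by
  have hl : (liftv w) (Fin.last d) = 1 := by simp [liftv]
  have hc : ∀ i : Fin (d + 1), ContDiffAt ℝ 3 (fun x : Fin (d + 1) → ℝ => x i) (liftv w) :=
    fun i => (contDiff_apply ℝ ℝ i).contDiffAt
  have h1 : ContDiffAt ℝ 3 (fun x : Fin (d + 1) → ℝ => fun i : Fin d =>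
      x i.castSucc / x (Fin.last d)) (liftv w) := by
    refine contDiffAt_pi.2 fun i => ?_
    exact (hc _).div (hc _) (by rw [hl]; norm_num)
  have h2 : ContDiffAt ℝ 3 (fun x : Fin (d + 1) → ℝ =>
      ψ (fun i : Fin d => x i.castSucc / x (Fin.last d))) (liftv w) := by
    refine ContDiffAt.comp (liftv w) (g := ψ) ?_ h1
    convert h using 1
    ext i
    simp [liftv]
  have h3 : ContDiffAt ℝ 3 (fun x : Fin (d + 1) → ℝ => Real.log (x (Fin.last d))) (liftv w) :=
    (hc _).log (by rw [hl]; norm_num)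
  exact contDiffAt_const.mul (h2.sub (contDiffAt_const.mul h3))

lemma der1_lift {d : ℕ} {ψ : (Fin d → ℝ) → ℝ} (ν : ℝ) {w : Fin d → ℝ} (hw : ContDiffAt ℝ 3 ψ w)
    (h : Fin d → ℝ) :
    der1 (liftedBarrier ψ ν) (liftv w) (lift0 h) = 400 * der1 ψ w h := by
  have a := hd0 (x := liftv w) (h := lift0 h) (τ := 0) (f := liftedBarrier ψ ν)
    (by simpa using lb_cd ν hw)
  have b := (hd0 (x := w) (h := h) (τ := 0) (f := ψ) (by simpa using hw)).const_mul 400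
  simp only [lift_line, lb_lift] at a
  simpa using a.unique b

lemma der2_lift {d : ℕ} {K : Set (Fin d → ℝ)} {ψ : (Fin d → ℝ) → ℝ} {ν : ℝ} (hψ : IsSCB K ψ ν)
    {w : Fin d → ℝ} (hw : w ∈ interior K) (h : Fin d → ℝ) :
    der2 (liftedBarrier ψ ν) (liftv w) (lift0 h) (lift0 h) = 400 * der2 ψ w h h := by
  have hw' := scb_cd hψ hw
  have a := hd1 (x := liftv w) (h := lift0 h) (τ := 0) (f := liftedBarrier ψ ν)
    (by simpa using lb_cd ν hw')
  have b := (hd1 (x := w) (h := h) (τ := 0) (f := ψ) (by simpa using hw')).const_mul 400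
  simp only [lift_line] at a
  have cl : ContinuousAt (fun τ : ℝ => w + τ • h) 0 := by fun_prop
  have e2 : ∀ᶠ τ in nhds (0:ℝ), w + τ • h ∈ interior K :=
    cl.eventually_mem (isOpen_interior.mem_nhds (by simpa using hw))
  have e3 : (fun τ : ℝ => der1 (liftedBarrier ψ ν) (liftv (w + τ • h)) (lift0 h)) =ᶠ[nhds 0]
      (fun τ : ℝ => 400 * der1 ψ (w + τ • h) h) := by
    filter_upwards [e2] with τ h2 using der1_lift ν (scb_cd hψ h2) h
  simpa using a.unique (b.congr_of_eventuallyEq e3)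

lemma hess_frontier {d : ℕ} {K : Set (Fin d → ℝ)} (hK : Convex ℝ K) (hint : (interior K).Nonempty)
    {ψ : (Fin d → ℝ) → ℝ} {ν : ℝ} (hψ : IsSCB K ψ ν) {u : Fin d → ℝ} (hu : u ∈ frontier K) :
    hess (liftedBarrier ψ ν) (liftv u) = 0 := by
  by_cases hD : DifferentiableAt ℝ (fderiv ℝ (liftedBarrier ψ ν)) (liftv u)
  swap
  · ext i j
    simp [hess, der2, iteratedFDeriv_two_apply, fderiv_zero_of_not_differentiableAt hD]
  exfalso
  obtain ⟨p, hp⟩ := hint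
  set k := lift0 (p - u) with hk
  have hin : ∀ τ ∈ Set.Ioc (0:ℝ) 1, u + τ • (p - u) ∈ interior K := fun τ hτ =>
    hK.add_smul_sub_mem_interior' hu.1 hp hτ
  have cl : ContinuousAt (fun τ : ℝ => liftv u + τ • k) 0 := by fun_prop
  have c1 : ContinuousAt (fun τ : ℝ => |der1 (liftedBarrier ψ ν) (liftv u + τ • k) k|) 0 := by
    have := (ContinuousAt.comp_of_eq hD.continuousAt cl (by simp)).clm_apply
      (continuousAt_const (y := k))
    exact this.abs
  obtain ⟨M, hM⟩ : ∃ M, |der1 (liftedBarrier ψ ν) (liftv u + (0:ℝ) • k) k| < M := exists_gt _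
  have e1 := c1.eventually_lt (continuousAt_const (y := M)) hM
  obtain ⟨δ, hδ, hball⟩ := Metric.eventually_nhds_iff.1 e1
  set r := min (δ / 2) 1 with hr
  have hr0 : 0 < r := lt_min (by linarith) one_pos
  have hr1 : r ≤ 1 := min_le_right _ _
  have hrδ : r < δ := (min_le_left _ _).trans_lt (by linarith)
  have hbd : ∀ τ ∈ Set.Ioc 0 r, 400 * ψ (u + τ • (p - u)) ≤ 400 * ψ (u + r • (p - u)) + M := by
    intro τ hτ
    have := (convex_Ioc 0 r).norm_image_sub_le_of_norm_hasDerivWithin_le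
      (f := fun τ : ℝ => liftedBarrier ψ ν (liftv u + τ • k)) (C := M)
      (fun x hx => (hd0 (by
        rw [hk, lift_line]
        exact lb_cd ν (scb_cd hψ (hin x ⟨hx.1, hx.2.trans hr1⟩)))).hasDerivWithinAt)
      (fun x hx => (hball (by
        rw [Real.dist_eq, sub_zero, abs_of_pos hx.1]; exact hx.2.trans_lt hrδ)).le)
      (x := r) (y := τ) ⟨hr0, le_rfl⟩ hτ
    simp only [hk, lift_line, lb_lift, Real.norm_eq_abs] at this
    have h3 := (abs_le.1 this).2
    have h4 : |τ - r| ≤ 1 := by rw [abs_le]; constructor <;> linarith [hτ.1, hτ.2]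
    have hM0 : 0 ≤ M := (abs_nonneg _).trans hM.le
    nlinarith
  have cl2 : Continuous (fun τ : ℝ => u + τ • (p - u)) := by fun_prop
  have ht : Filter.Tendsto (fun τ : ℝ => u + τ • (p - u)) (nhdsWithin 0 (Set.Ioi 0))
      (nhdsWithin u (interior K)) := by
    refine tendsto_nhdsWithin_iff.2 ⟨?_, ?_⟩
    · simpa using (cl2.tendsto 0).mono_left nhdsWithin_le_nhds
    · filter_upwards [Ioc_mem_nhdsGT one_pos] with τ hτ using hin τ hτ
  have hb := ((hψ.blowup _ hu).comp ht).eventually_gt_atTop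
    ((400 * ψ (u + r • (p - u)) + M) / 400)
  obtain ⟨τ, h3, h4⟩ := (hb.and (Ioc_mem_nhdsGT hr0)).exists
  have h5 := hbd τ h4
  simp only [Function.comp] at h3
  rw [div_lt_iff₀ (by norm_num)] at h3
  linarith

lemma interior_of_posDef {d : ℕ} {K : Set (Fin d → ℝ)} (hK : Convex ℝ K)
    (hint : (interior K).Nonempty)
    {ψ : (Fin d → ℝ) → ℝ} {ν : ℝ} (hψ : IsSCB K ψ ν) {x : Fin (d + 1) → ℝ}
    (hx : x ∈ liftv '' K) {R : Matrix (Fin (d + 1)) (Fin (d + 1)) ℝ} (hR : R.PosDef)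
    (hRR : R * R = hess (liftedBarrier ψ ν) x) : ∃ w ∈ interior K, x = liftv w := by
  obtain ⟨w, hw, rfl⟩ := hx
  refine ⟨w, ?_, rfl⟩
  by_contra hn
  rw [hess_frontier hK hint hψ ⟨subset_closure hw, hn⟩] at hRR
  have := hR.isUnit.mul hR.isUnit
  rw [hRR] at this
  exact not_isUnit_zero this

lemma dotp_symm {n : ℕ} {R : Matrix (Fin n) (Fin n) ℝ} (hR : R.IsSymm) (x y : Fin n → ℝ) :
    dotp x (R.mulVec y) = dotp (R.mulVec x) y := by
  change x ⬝ᵥ R.mulVec y = R.mulVec x ⬝ᵥ y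
  rw [Matrix.dotProduct_mulVec, ← Matrix.mulVec_transpose, hR.eq]

lemma dotp_cs {n : ℕ} (x y : Fin n → ℝ) (hy : dotp y y = 1) : |dotp x y| ≤ √(dotp x x) := by
  apply Real.abs_le_sqrt
  have := Finset.sum_mul_sq_le_sq_mul_sq Finset.univ x y
  simp only [dotp] at *
  simp only [← pow_two] at *
  rw [hy, mul_one] at this
  exact this

lemma mink_self {n : ℕ} {K : Set (Fin n → ℝ)} {w : Fin n → ℝ} (hw : w ∈ K) {c : ℝ} (hc : 0 < c) :
    mink K w w ≤ c := by
  refine csInf_le ⟨0, fun s hs => hs.1.le⟩ ⟨hc, by simpa using hw⟩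

/-- **Lemma B.12: stability of the OMD step.**
If the initial learning rate satisfies `η ≤ 1/(80d)`, then Algorithm 2 guarantees
`‖w⁺_t − w⁺_{t+1}‖_{H_t} ≤ 40 η ‖ℓ̂⁺_t‖_{H_t⁻¹}` for all `t ∈ [T]`,
where `H_t = ∇²Ψ(w⁺_t)`. -/
theorem omd_step_stability
    (d T : ℕ) (hd : 1 ≤ d) (hT : 2 ≤ T) (ν η : ℝ) (hν : 1 ≤ ν) (hη : 0 < η)
    (hη80 : η ≤ 1 / (80 * (d : ℝ)))
    (Ωs : Set (Fin d → ℝ)) (hconv : Convex ℝ Ωs) (hcomp : IsCompact Ωs)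
    (hint : (interior Ωs).Nonempty)
    (ψ : (Fin d → ℝ) → ℝ) (hψ : IsSCB Ωs ψ ν)
    (ℓv : ℕ → Fin d → ℝ) (hℓ : ∀ t ∈ Finset.Icc 1 T, ∀ w ∈ Ωs, |dotp w (ℓv t)| ≤ 1)
    (sv wp : ℕ → Fin (d + 1) → ℝ)
    (R : ℕ → Matrix (Fin (d + 1)) (Fin (d + 1)) ℝ)
    (ηv : ℕ → ℝ) (S : ℕ → Finset ℕ)
    -- abbreviations
    (Ψ : (Fin (d + 1) → ℝ) → ℝ) (hΨ : Ψ = liftedBarrier ψ ν)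
    (Ωp : Set (Fin (d + 1) → ℝ)) (hΩp : Ωp = liftv '' Ωs)
    (H : ℕ → Matrix (Fin (d + 1)) (Fin (d + 1)) ℝ) (hH : ∀ t, H t = hess Ψ (wp t))
    (elast : Fin (d + 1) → ℝ) (helast : elast = Pi.single (Fin.last d) 1)
    (lp : ℕ → Fin (d + 1) → ℝ) (hlp : ∀ t, lp t = Fin.snoc (ℓv t) 0)
    (wt : ℕ → Fin (d + 1) → ℝ) (hwt : ∀ t, wt t = wp t + (R t)⁻¹.mulVec (sv t))
    (lh : ℕ → Fin (d + 1) → ℝ)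
    (hlh : ∀ t, lh t = ((d : ℝ) * dotp (wt t) (lp t)) • (R t).mulVec (sv t))
    (Ωp' : Set (Fin (d + 1) → ℝ))
    (hΩp' : Ωp' = {x ∈ Ωp | mink Ωp (wp 1) x ≤ 1 - 1 / (T : ℝ)})
    -- Algorithm 2
    (hinit : wp 1 ∈ Ωp ∧ ∀ y ∈ Ωp, Ψ (wp 1) ≤ Ψ y)
    (hR : ∀ t ∈ Finset.Icc 1 (T + 1), (R t).PosDef ∧ (R t).IsSymm ∧ R t * R t = H t)
    (hs : ∀ t ∈ Finset.Icc 1 T,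
      dotp (sv t) (sv t) = 1 ∧ dotp (sv t) ((R t)⁻¹.mulVec elast) = 0)
    (hupd : ∀ t ∈ Finset.Icc 1 T, wp (t + 1) ∈ Ωp' ∧ ∀ y ∈ Ωp',
      dotp (wp (t + 1)) (lh t) + (1 / ηv t) * breg Ψ (wp (t + 1)) (wp t)
        ≤ dotp y (lh t) + (1 / ηv t) * breg Ψ y (wp t))
    (hη1 : ηv 1 = η) (hS1 : S 1 = {1})
    (hsch : ∀ t ∈ Finset.Icc 1 T,
      ((∃ p : Fin (d + 1) → ℝ,
          0 < dotp p ((H (t + 1) - ∑ τ ∈ S t, H τ).mulVec p)) →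
        S (t + 1) = insert (t + 1) (S t) ∧
        ηv (t + 1) = Real.exp (1 / (100 * d * Real.log (ν * T))) * ηv t) ∧
      (¬ (∃ p : Fin (d + 1) → ℝ,
          0 < dotp p ((H (t + 1) - ∑ τ ∈ S t, H τ).mulVec p)) →
        S (t + 1) = S t ∧ ηv (t + 1) = ηv t))
    -- guaranteed by the learning-rate schedule
    (hη5 : ∀ t ∈ Finset.Icc 1 T, ηv t ≤ 5 * η) :
    ∀ t ∈ Finset.Icc 1 T,
      qnorm (H t) (wp t - wp (t + 1)) ≤ 40 * η * qnorm (H t)⁻¹ (lh t) := by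
  intro t ht
  have hsch' := hsch
  have ht1 := (Finset.mem_Icc.1 ht).1
  have htT := (Finset.mem_Icc.1 ht).2
  -- positivity of the learning rates
  have hpos : ∀ n, n + 1 ≤ T → 0 < ηv (n + 1) := by
    intro n
    induction n with
    | zero => intro _; simpa [hη1] using hη
    | succ m ih =>
      intro hm
      have ihm := ih (by omega)
      have h1 := hsch (m + 1) (Finset.mem_Icc.2 ⟨by omega, by omega⟩)
      by_cases hc : ∃ p : Fin (d + 1) → ℝ,
          0 < dotp p ((H (m + 1 + 1) - ∑ τ ∈ S (m + 1), H τ).mulVec p)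
      · rw [(h1.1 hc).2]; positivity
      · rw [(h1.2 hc).2]; exact ihm
  have hηt : 0 < ηv t := by
    obtain ⟨m, rfl⟩ : ∃ m, t = m + 1 := ⟨t - 1, by omega⟩
    exact hpos m htT
  have hT0 : (0:ℝ) < 1 - 1 / (T : ℝ) := by
    have : (2:ℝ) ≤ T := by exact_mod_cast hT
    rw [sub_pos, div_lt_one (by linarith)]; linarith
  -- membership
  have hmem' : ∀ n, n + 1 ≤ T + 1 → wp (n + 1) ∈ Ωp' := by
    intro n hn
    rcases Nat.eq_zero_or_pos n with rfl | h0
    · rw [hΩp']; exact ⟨hinit.1, mink_self hinit.1 hT0⟩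
    · exact (hupd n (Finset.mem_Icc.2 ⟨h0, by omega⟩)).1
  have hmt : wp t ∈ Ωp' := by
    obtain ⟨m, rfl⟩ : ∃ m, t = m + 1 := ⟨t - 1, by omega⟩
    exact hmem' m (by omega)
  have hsub : ∀ x ∈ Ωp', x ∈ liftv '' Ωs := by
    intro x hx; rw [hΩp'] at hx; rw [← hΩp]; exact hx.1
  have hRt := hR t (Finset.mem_Icc.2 ⟨ht1, by omega⟩)
  have hRt1 := hR (t + 1) (Finset.mem_Icc.2 ⟨by omega, by omega⟩)
  have hup := hupd t ht
  obtain ⟨w, hw, hwe⟩ := interior_of_posDef hconv hint hψ (hsub _ hmt) hRt.1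
    (by rw [hRt.2.2, hH, hΨ])
  obtain ⟨u, hu, hue⟩ := interior_of_posDef hconv hint hψ (hsub _ hup.1) hRt1.1
    (by rw [hRt1.2.2, hH, hΨ])
  have hHt : H t = hess (liftedBarrier ψ ν) (liftv w) := by rw [hH, hΨ, hwe]
  have hquad : ∀ h, dotp (lift0 h) ((H t).mulVec (lift0 h)) = 400 * der2 ψ w h h := by
    intro h; rw [hHt, hess_quad, der2_lift hψ hw]
  set Rt := R t with hRtdef
  have hRR : Rt * Rt = H t := hRt.2.2
  have hsym := hRt.2.1
  have hdet : IsUnit Rt.det := (Matrix.isUnit_iff_isUnit_det _).1 hRt.1.isUnit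
  have hRquad : ∀ x, dotp (Rt.mulVec x) (Rt.mulVec x) = dotp x ((H t).mulVec x) := by
    intro x
    rw [← hRR, ← Matrix.mulVec_mulVec, dotp_symm hsym x]
  have hs1 := (hs t ht).1
  have hs2 := (hs t ht).2
  have hisym : (Rt⁻¹).IsSymm := by
    unfold Matrix.IsSymm
    rw [Matrix.transpose_nonsing_inv, hsym.eq]
  -- the sampling direction
  set v := Rt⁻¹.mulVec (sv t) with hv
  have hRv : Rt.mulVec v = sv t := by
    rw [hv, Matrix.mulVec_mulVec, Matrix.mul_nonsing_inv _ hdet, Matrix.one_mulVec]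
  have hvl : v (Fin.last d) = 0 := by
    rw [dotp_symm hisym, helast] at hs2
    simpa [dotp, Pi.single_apply] using hs2
  obtain ⟨v', hv'⟩ : ∃ v', v = lift0 v' := by
    refine ⟨fun i => v i.castSucc, ?_⟩
    ext i
    refine Fin.lastCases ?_ (fun j => ?_) i <;> simp [lift0, hvl]
  have hvq : 400 * der2 ψ w v' v' = 1 := by
    rw [← hquad, ← hv', ← hRquad, hRv, hs1]
  have hwv : w + v' ∈ interior Ωs := by
    apply dikin hψ hw
    rw [Real.sqrt_le_left (by norm_num)]
    linarith
  set c := (d : ℝ) * dotp (wt t) (lp t) with hc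
  have hcd : |c| ≤ d := by
    have e : dotp (wt t) (lp t) = dotp (w + v') (ℓv t) := by
      rw [hwt, hlp, ← hRtdef, ← hv, hwe, hv', lift_add]
      simp [dotp, Fin.sum_univ_castSucc, liftv]
    rw [hc, e, abs_mul, Nat.abs_cast]
    exact mul_le_of_le_one_right (Nat.cast_nonneg _) (hℓ t ht _ (interior_subset hwv))
  have hlht : lh t = c • Rt.mulVec (sv t) := hlh t
  have hqinv : qnorm (H t)⁻¹ (lh t) = |c| := by
    have e : dotp (lh t) ((H t)⁻¹.mulVec (lh t)) = c ^ 2 := by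
      rw [← hRR, Matrix.mul_inv_rev, ← Matrix.mulVec_mulVec, dotp_symm hisym, hlht,
        Matrix.mulVec_smul, Matrix.mulVec_mulVec, Matrix.nonsing_inv_mul _ hdet, Matrix.one_mulVec]
      have : dotp (c • sv t) (c • sv t) = c ^ 2 * dotp (sv t) (sv t) := by
        simp only [dotp, Finset.mul_sum, Pi.smul_apply, smul_eq_mul]
        exact Finset.sum_congr rfl fun _ _ => by ring
      rw [this, hs1, mul_one]
    rw [qnorm, e, Real.sqrt_sq_eq_abs]
  -- the step
  set h := u - w with hh
  set ρ := √(der2 ψ w h h) with hρ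
  have hρ0 : 0 ≤ ρ := Real.sqrt_nonneg _
  have h20 : √(400 * der2 ψ w h h) = 20 * ρ := by
    rw [Real.sqrt_mul (by norm_num), hρ]
    congr 1
    rw [show (400:ℝ) = 20 ^ 2 by norm_num, Real.sqrt_sq (by norm_num)]
  have hql : qnorm (H t) (wp t - wp (t + 1)) = 20 * ρ := by
    have e : wp t - wp (t + 1) = -lift0 h := by
      rw [hwe, hue, hh, ← lift_sub, neg_sub]
    have e2 : dotp (-lift0 h) ((H t).mulVec (-lift0 h)) = dotp (lift0 h) ((H t).mulVec (lift0 h)) := by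
      change (-lift0 h) ⬝ᵥ _ = lift0 h ⬝ᵥ _
      rw [Matrix.mulVec_neg, neg_dotProduct_neg]
    rw [qnorm, e, e2, hquad, h20]
  have hdot : |dotp (lift0 h) (lh t)| ≤ |c| * (20 * ρ) := by
    have e : dotp (lift0 h) (lh t) = c * dotp (Rt.mulVec (lift0 h)) (sv t) := by
      rw [← dotp_symm hsym, hlht]
      simp only [dotp, Finset.mul_sum, Pi.smul_apply, smul_eq_mul]
      exact Finset.sum_congr rfl fun _ _ => by ring
    rw [e, abs_mul]
    gcongr
    rw [← h20, ← hquad, ← hRquad]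
    exact dotp_cs _ _ hs1
  have hseg : ∀ τ ∈ Set.Icc (0:ℝ) 1, w + τ • h ∈ interior Ωs := fun τ hτ =>
    hconv.interior.add_smul_sub_mem hw hu hτ
  have hgap := gap1d (g := fun τ => ψ (w + τ • h)) (g1 := fun τ => der1 ψ (w + τ • h) h)
    (g2 := fun τ => der2 ψ (w + τ • h) h h)
    (fun τ hτ => hd0 (scb_cd hψ (hseg τ hτ))) (fun τ hτ => hd1 (scb_cd hψ (hseg τ hτ)))
    (fun τ hτ => scb_nonneg hψ (hseg τ hτ) h)
    (fun τ hτ => by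
      have := sc1d (convex_Icc 0 1) (y := fun τ => der2 ψ (w + τ • h) h h)
        (fun τ hτ => hd2 (scb_cd hψ (hseg τ hτ))) (fun τ hτ => scb_nonneg hψ (hseg τ hτ) h)
        (fun τ hτ => hψ.selfConc _ (hseg τ hτ) h) (a := 0) (b := τ) (by simp) hτ
      simpa only [sub_zero, abs_of_nonneg hτ.1] using this)
  simp only [zero_smul, add_zero, one_smul] at hgap
  rw [← hρ, show w + h = u by rw [hh]; abel] at hgap
  have hb1 : breg Ψ (wp (t + 1)) (wp t) = 400 * (ψ u - ψ w - der1 ψ w h) := by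
    rw [breg, grad_dot, hwe, hue, lift_sub, hΨ, der1_lift ν (scb_cd hψ hw), lb_lift, lb_lift]
    ring
  have hb0 : breg Ψ (wp t) (wp t) = 0 := by
    simp [breg, dotp]
  have hopt := hup.2 _ hmt
  rw [hb1, hb0, mul_zero, add_zero] at hopt
  have hdd : dotp (wp (t + 1)) (lh t) - dotp (wp t) (lh t) = dotp (lift0 h) (lh t) := by
    rw [hh, ← lift_sub, ← hwe, ← hue]
    exact (sub_dotProduct _ _ _).symm
  have h1 : 1 / ηv t * (400 * (ψ u - ψ w - der1 ψ w h)) ≤ |c| * (20 * ρ) := by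
    have := neg_abs_le (dotp (lift0 h) (lh t))
    linarith
  have h2 : 400 * (ψ u - ψ w - der1 ψ w h) ≤ ηv t * (|c| * (20 * ρ)) := by
    rw [one_div, inv_mul_le_iff₀ hηt] at h1
    exact h1
  have h3 : 400 * (ρ ^ 2 / (2 * (1 + ρ))) ≤ 5 * η * (|c| * (20 * ρ)) := by
    have : ηv t * (|c| * (20 * ρ)) ≤ 5 * η * (|c| * (20 * ρ)) :=
      mul_le_mul_of_nonneg_right (hη5 t ht) (by positivity)
    linarith
  have hd0' : (0:ℝ) < d := by exact_mod_cast hd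
  have hε : η * |c| ≤ 1 / 80 := by
    calc η * |c| ≤ 1 / (80 * (d : ℝ)) * d := by gcongr
      _ = 1 / 80 := by field_simp
  have hε0 : 0 ≤ η * |c| := by positivity
  rw [hql, hqinv]
  rcases hρ0.eq_or_lt with h0 | h0
  · rw [← h0]; linarith
  · have h4 : 200 * ρ ^ 2 ≤ 100 * (η * |c|) * ρ * (1 + ρ) := by
      have e : 400 * (ρ ^ 2 / (2 * (1 + ρ))) = 200 * ρ ^ 2 / (1 + ρ) := by
        field_simp; norm_num
      rw [e, div_le_iff₀ (by positivity)] at h3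
      linarith
    have h5 : 2 * ρ ≤ (η * |c|) * (1 + ρ) := by
      have : ρ * (2 * ρ) ≤ ρ * ((η * |c|) * (1 + ρ)) := by linarith
      exact le_of_mul_le_mul_left this h0
    nlinarith [mul_le_mul_of_nonneg_right hε hρ0]
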